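/- Fix points a, b ∈ EuclideanSpace ℝ (Fin 2), headings α, β ∈ ℝ, and a minimum turning radius r_min > 0. If there exists a feasible trajectory of length s > 0 from the oriented point (a, α) to the oriented point (b, β), then for every l ≥ s + 2π·r_min there exists a feasible trajectory of length exactly l from (a, α) to (b, β). That is, every length exceeding a reachable length by at least the perimeter 2π·r_min of a minimum-radius circle is again reachable. -/

import Mathlib

/-- The point of the Euclidean plane with coordinates `(x, y)`. -/
noncomputable def planePt (x y : ℝ) : EuclideanSpace ℝ (Fin 2) :=
  (WithLp.equiv 2 (Fin 2 → ℝ)).symm ![x, y]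

/-- A feasible curvature-bounded trajectory of length `s` from the oriented point
`(a, α)` to the oriented point `(b, β)`: a unit-speed `C¹` path `Λ` with velocity `v`,
matching endpoints and headings, whose velocity is `(1/r_min)`-Lipschitz on `[0, s]`
(the curvature bound `‖Λ''‖ ≤ 1/r_min`). -/
def FeasibleTrajectory (a b : EuclideanSpace ℝ (Fin 2)) (α β : ℝ) (r_min s : ℝ)
    (Λ v : ℝ → EuclideanSpace ℝ (Fin 2)) : Prop :=
  (∀ t ∈ Set.Icc (0 : ℝ) s, HasDerivAt Λ (v t) t) ∧
  (∀ t ∈ Set.Icc (0 : ℝ) s, ‖v t‖ = 1) ∧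
  Λ 0 = a ∧ Λ s = b ∧
  v 0 = planePt (Real.cos α) (Real.sin α) ∧
  v s = planePt (Real.cos β) (Real.sin β) ∧
  LipschitzOnWith (1 / r_min).toNNReal v (Set.Icc (0 : ℝ) s)

/-- Two feasible trajectories whose oriented endpoints match can be concatenated, and the
lengths add up. -/
theorem FeasibleTrajectory.exists_concat {a b c : EuclideanSpace ℝ (Fin 2)} {α β γ r s t : ℝ}
    {Λ v M w : ℝ → EuclideanSpace ℝ (Fin 2)} (hs : 0 ≤ s) (ht : 0 ≤ t)
    (h₁ : FeasibleTrajectory a b α β r s Λ v) (h₂ : FeasibleTrajectory b c β γ r t M w) :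
    ∃ N u : ℝ → EuclideanSpace ℝ (Fin 2), FeasibleTrajectory a c α γ r (s + t) N u := by
  obtain ⟨hΛ, hv, hΛ0, hΛs, hv0, hvs, hvL⟩ := h₁
  obtain ⟨hM, hw, hM0, hMt, hw0, hwt, hwL⟩ := h₂
  have hN_right (x : ℝ) (hx : s ≤ x) : (if x ≤ s then Λ x else M (x - s)) = M (x - s) := by
    split_ifs with h
    · obtain rfl := le_antisymm h hx
      simp [hΛs, hM0]
    · rfl
  have hu_right (x : ℝ) (hx : s ≤ x) : (if x ≤ s then v x else w (x - s)) = w (x - s) := by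
    split_ifs with h
    · obtain rfl := le_antisymm h hx
      simp [hvs, hw0]
    · rfl
  refine ⟨fun x ↦ if x ≤ s then Λ x else M (x - s), fun x ↦ if x ≤ s then v x else w (x - s),
    fun x hx ↦ ?_, fun x hx ↦ ?_, by simp [hs, hΛ0], ?_, by simp [hs, hv0], ?_, ?_⟩
  · have hM' (hsx : s ≤ x) : HasDerivAt (fun y ↦ M (y - s)) (w (x - s)) x :=
      (hM (x - s) ⟨by linarith, by linarith [hx.2]⟩).comp_sub_const x s
    rcases lt_trichotomy x s with hxs | rfl | hxs
    · simp only [hxs.le, if_true]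
      refine (hΛ x ⟨hx.1, hxs.le⟩).congr_of_eventuallyEq ?_
      filter_upwards [Iio_mem_nhds hxs] with y hy
      exact if_pos (le_of_lt hy)
    · have hleft : HasDerivWithinAt (fun y ↦ if y ≤ x then Λ y else M (y - x)) (v x)
          (Set.Iic x) x :=
        (hΛ x ⟨hs, le_rfl⟩).hasDerivWithinAt.congr (fun y hy ↦ if_pos hy) (if_pos le_rfl)
      have hright : HasDerivWithinAt (fun y ↦ if y ≤ x then Λ y else M (y - x)) (v x)
          (Set.Ici x) x := by
        have hvw : v x = w (x - x) := by simp [hvs, hw0]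
        rw [hvw]
        exact (hM' le_rfl).hasDerivWithinAt.congr hN_right (hN_right x le_rfl)
      simp only [le_refl, if_true]
      simpa [Set.Iic_union_Ici, hasDerivWithinAt_univ] using hleft.union hright
    · simp only [hxs.not_ge, if_false]
      refine (hM' hxs.le).congr_of_eventuallyEq ?_
      filter_upwards [Ioi_mem_nhds hxs] with y hy
      exact hN_right y (le_of_lt hy)
  · dsimp only
    split_ifs with h
    · exact hv x ⟨hx.1, h⟩
    · exact hw (x - s) ⟨by linarith, by linarith [hx.2]⟩
  · simpa [hMt] using hN_right (s + t) (by linarith)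
  · simpa [hwt] using hu_right (s + t) (by linarith)
  · have key : ∀ x ∈ Set.Icc 0 (s + t), ∀ y ∈ Set.Icc 0 (s + t), x ≤ y →
        dist (if x ≤ s then v x else w (x - s)) (if y ≤ s then v y else w (y - s)) ≤
          (1 / r).toNNReal * dist x y := by
      intro x hx y hy hxy
      rcases le_total y s with hys | hys
      · simpa [hys, hxy.trans hys] using
          hvL.dist_le_mul x ⟨hx.1, hxy.trans hys⟩ y ⟨hy.1, hys⟩
      · rw [hu_right y hys]
        have hy' : y - s ∈ Set.Icc 0 t := ⟨by linarith, by linarith [hy.2]⟩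
        rcases le_total s x with hsx | hxs
        · rw [hu_right x hsx]
          simpa using hwL.dist_le_mul (x - s) ⟨by linarith, by linarith [hx.2]⟩ (y - s) hy'
        · rw [if_pos hxs]
          have h₁ := hvL.dist_le_mul x ⟨hx.1, hxs⟩ s ⟨hs, le_rfl⟩
          have h₂ := hwL.dist_le_mul 0 ⟨le_rfl, ht⟩ (y - s) hy'
          rw [hw0, ← hvs] at h₂
          have hd : dist x y = dist x s + dist 0 (y - s) := by
            rw [Real.dist_eq, Real.dist_eq, Real.dist_eq, abs_of_nonpos (by linarith),
              abs_of_nonpos (by linarith), abs_of_nonpos (by linarith)]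
            ring
          rw [hd, mul_add]
          exact (dist_triangle _ (v s) _).trans (add_le_add h₁ h₂)
    refine LipschitzOnWith.of_dist_le_mul fun x hx y hy ↦ ?_
    rcases le_total x y with hxy | hxy
    · exact key x hx y hy hxy
    · rw [dist_comm, dist_comm x]
      exact key y hy x hx hxy

/-- Coordinatewise differentiation of a plane curve. -/
theorem HasDerivAt.planePt {f g : ℝ → ℝ} {f' g' x : ℝ} (hf : HasDerivAt f f' x)
    (hg : HasDerivAt g g' x) :
    HasDerivAt (fun t ↦ planePt (f t) (g t)) (_root_.planePt f' g') x := by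
  have h : HasDerivAt (fun t ↦ ![f t, g t]) ![f', g'] x :=
    hasDerivAt_pi.2 fun i ↦ by fin_cases i <;> simpa
  exact (PiLp.hasFDerivAt_toLp 2 _).comp_hasDerivAt x h

theorem norm_planePt (x y : ℝ) : ‖planePt x y‖ = √(x ^ 2 + y ^ 2) := by
  simp [planePt, EuclideanSpace.norm_eq, Fin.sum_univ_two]

/-- A full circle of radius `R ≥ r` is a feasible trajectory from any oriented point to
itself. -/
theorem feasibleTrajectory_circle (a : EuclideanSpace ℝ (Fin 2)) (α : ℝ) {r R : ℝ} (hr : 0 < r)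
    (hR : r ≤ R) :
    FeasibleTrajectory a a α α r (2 * Real.pi * R)
      (fun t ↦ a + (planePt (R * Real.sin (α + t / R)) (-(R * Real.cos (α + t / R))) -
        planePt (R * Real.sin α) (-(R * Real.cos α))))
      (fun t ↦ planePt (Real.cos (α + t / R)) (Real.sin (α + t / R))) := by
  have hR0 : 0 < R := hr.trans_le hR
  have hfull : α + 2 * Real.pi * R / R = α + 2 * Real.pi := by field_simp
  have hangle (t : ℝ) : HasDerivAt (fun t ↦ α + t / R) (1 / R) t :=
    ((hasDerivAt_id t).div_const R).const_add α
  refine ⟨fun t _ ↦ ?_, fun t _ ↦ ?_, by simp, ?_, by simp, ?_, ?_⟩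
  · refine HasDerivAt.const_add _ (HasDerivAt.sub_const _ ?_)
    refine HasDerivAt.planePt ?_ ?_
    · refine ((hangle t).sin.const_mul R).congr_deriv ?_
      field_simp
    · refine ((hangle t).cos.const_mul R).neg.congr_deriv ?_
      field_simp
  · rw [norm_planePt, Real.cos_sq_add_sin_sq, Real.sqrt_one]
  · simp [hfull]
  · simp [hfull]
  · refine (convex_Icc _ _).lipschitzOnWith_of_nnnorm_hasDerivWithin_le
      (fun t _ ↦ ((hangle t).cos.planePt (hangle t).sin).hasDerivWithinAt) fun t _ ↦ ?_
    rw [← NNReal.coe_le_coe, coe_nnnorm, norm_planePt,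
      Real.coe_toNNReal _ (by positivity), mul_pow, mul_pow, neg_sq, ← add_mul,
      Real.sin_sq_add_cos_sq, one_mul, Real.sqrt_sq (by positivity)]
    exact one_div_le_one_div_of_le hr hR

/-- If a feasible trajectory of length `s > 0` exists between two oriented points, then
every length `l ≥ s + 2π·r_min` (exceeding `s` by at least the perimeter of a
minimum-radius circle) is also reachable by a feasible trajectory. -/
theorem reachable_lengths_elongation
    (a b : EuclideanSpace ℝ (Fin 2)) (α β : ℝ) (r_min : ℝ) (hr : 0 < r_min)
    (s : ℝ) (hs : 0 < s)
    (h : ∃ Λ v : ℝ → EuclideanSpace ℝ (Fin 2), FeasibleTrajectory a b α β r_min s Λ v) :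
    ∀ l ≥ s + 2 * Real.pi * r_min, ∃ Λ v : ℝ → EuclideanSpace ℝ (Fin 2),
      FeasibleTrajectory a b α β r_min l Λ v := by
  intro l hl
  obtain ⟨Λ, v, h⟩ := h
  have hpi : 0 < 2 * Real.pi := by positivity
  have hR : r_min ≤ (l - s) / (2 * Real.pi) := by
    rw [le_div_iff₀ hpi]
    linarith
  have hlen : 2 * Real.pi * ((l - s) / (2 * Real.pi)) + s = l := by
    rw [mul_div_cancel₀ _ hpi.ne', sub_add_cancel]
  rw [← hlen]
  exact (feasibleTrajectory_circle a α hr hR).exists_concat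
    (mul_nonneg hpi.le (hr.le.trans hR)) hs.le h
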